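/- arXiv:hep-th/0409290 — 3 statements merged into one kernel-verified Lean document; each statement's English description precedes it below -/
import Mathlib

section
/- Let Γ be an even selfdual ℤ-lattice and let L ⊆ Γ be a primitive sublattice with L ∩ L^⊥ = {0}, where L^⊥ = {x ∈ Γ : ⟨x,y⟩ = 0 for all y ∈ L}. Then there exists a group isomorphism φ : L*/L → (L^⊥)*/(L^⊥) between the discriminant groups such that the discriminant forms differ by sign: q_{L^⊥}(φ(x̄)) = −q_L(x̄) in ℚ/2ℤ for every x̄ ∈ L*/L. -/
/-! A lattice is represented as a finitely generated `ℤ`-submodule of a rational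
vector space (its rationalization), spanning it over `ℚ`, together with a symmetric
bilinear form `Φ` that is integer valued on the lattice. -/

/-- The dual lattice `Λ* = {x ∈ span_ℚ Λ : ∀ l ∈ Λ, ⟨x,l⟩ ∈ ℤ}`. -/
def dualLattice {V : Type*} [AddCommGroup V] [Module ℚ V]
    (Φ : V →ₗ[ℚ] V →ₗ[ℚ] ℚ) (Λ : Submodule ℤ V) : Submodule ℤ V where
  carrier := {x | x ∈ Submodule.span ℚ (Λ : Set V) ∧ ∀ l ∈ Λ, ∃ n : ℤ, Φ x l = n}
  zero_mem' := ⟨Submodule.zero_mem _, fun l _ => ⟨0, by simp⟩⟩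
  add_mem' := by
    rintro x y ⟨hx, hx'⟩ ⟨hy, hy'⟩
    refine ⟨Submodule.add_mem _ hx hy, fun l hl => ?_⟩
    obtain ⟨m, hm⟩ := hx' l hl
    obtain ⟨n, hn⟩ := hy' l hl
    exact ⟨m + n, by rw [map_add, LinearMap.add_apply, hm, hn]; push_cast; ring⟩
  smul_mem' := by
    rintro c x ⟨hx, hx'⟩
    rw [← Int.cast_smul_eq_zsmul ℚ]
    refine ⟨Submodule.smul_mem _ _ hx, fun l hl => ?_⟩
    obtain ⟨n, hn⟩ := hx' l hl
    exact ⟨c * n, by rw [map_smul, LinearMap.smul_apply, hn, smul_eq_mul]; push_cast; ring⟩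

/-- The copy of the lattice `Λ` sitting inside its dual lattice. -/
def latticeInDual {V : Type*} [AddCommGroup V] [Module ℚ V]
    (Φ : V →ₗ[ℚ] V →ₗ[ℚ] ℚ) (Λ : Submodule ℤ V) : Submodule ℤ (dualLattice Φ Λ) :=
  Submodule.comap (dualLattice Φ Λ).subtype Λ

/-- The discriminant group `G_D(Λ) = Λ*/Λ`. -/
abbrev DiscGroup {V : Type*} [AddCommGroup V] [Module ℚ V]
    (Φ : V →ₗ[ℚ] V →ₗ[ℚ] ℚ) (Λ : Submodule ℤ V) : Type _ :=
  (dualLattice Φ Λ) ⧸ (latticeInDual Φ Λ)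

/-- The submodule of vectors orthogonal to all of `L`. -/
def orthogonalTo {V : Type*} [AddCommGroup V] [Module ℚ V]
    (Φ : V →ₗ[ℚ] V →ₗ[ℚ] ℚ) (L : Submodule ℤ V) : Submodule ℤ V where
  carrier := {x | ∀ y ∈ L, Φ x y = 0}
  zero_mem' := fun y _ => by simp
  add_mem' := by
    intro a b ha hb y hy
    rw [map_add, LinearMap.add_apply, ha y hy, hb y hy, add_zero]
  smul_mem' := by
    intro c x hx y hy
    rw [← Int.cast_smul_eq_zsmul ℚ, map_smul, LinearMap.smul_apply, hx y hy, smul_zero]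

section RationalLattice

variable {V : Type*} [AddCommGroup V]

theorem exists_retraction_of_primitive {Γ : Submodule ℤ V} (hfg : Γ.FG) {A : Submodule ℤ V}
    (hprim : ∀ x ∈ Γ, (∃ n : ℤ, n ≠ 0 ∧ n • x ∈ A) → x ∈ A) :
    ∃ P : Γ →ₗ[ℤ] Γ, (∀ g, (P g : V) ∈ A) ∧ ∀ g : Γ, (g : V) ∈ A → P g = g := by
  have := Module.Finite.iff_fg.2 hfg
  let A' : Submodule ℤ Γ := A.comap Γ.subtype
  have : Module.IsTorsionFree ℤ (Γ ⧸ A') := by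
    rw [Module.isTorsionFree_iff_smul_eq_zero]
    intro n q h
    obtain ⟨g, rfl⟩ := A'.mkQ_surjective q
    by_cases hn : n = 0
    · exact Or.inl hn
    · right
      rw [← map_smul, Submodule.mkQ_apply, Submodule.Quotient.mk_eq_zero] at h
      rw [Submodule.mkQ_apply, Submodule.Quotient.mk_eq_zero]
      exact hprim g g.2 ⟨n, hn, h⟩
  obtain ⟨s, hs⟩ := Module.projective_lifting_property A'.mkQ LinearMap.id A'.mkQ_surjective
  refine ⟨LinearMap.id - s.comp A'.mkQ, fun g => ?_, fun g hg => ?_⟩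
  · have : (LinearMap.id - s.comp A'.mkQ : Γ →ₗ[ℤ] Γ) g ∈ A' := by
      rw [← Submodule.Quotient.mk_eq_zero, ← Submodule.mkQ_apply, LinearMap.sub_apply, map_sub,
        sub_eq_zero]
      exact (DFunLike.congr_fun hs (A'.mkQ g)).symm
    exact this
  · have : A'.mkQ g = 0 := (Submodule.Quotient.mk_eq_zero A').2 hg
    simp [-Submodule.mkQ_apply, this]

variable [Module ℚ V]

theorem exists_zsmul_mem_of_mem_span_rat {A : Submodule ℤ V} {v : V}
    (hv : v ∈ Submodule.span ℚ (A : Set V)) : ∃ n : ℤ, n ≠ 0 ∧ n • v ∈ A := by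
  induction hv using Submodule.span_induction with
  | mem x hx => exact ⟨1, one_ne_zero, by simpa using hx⟩
  | zero => exact ⟨1, one_ne_zero, by simp⟩
  | add x y _ _ hx hy =>
    obtain ⟨m, hm, hmx⟩ := hx
    obtain ⟨n, hn, hny⟩ := hy
    refine ⟨m * n, mul_ne_zero hm hn, ?_⟩
    rw [smul_add]
    refine A.add_mem ?_ ?_
    · rw [mul_comm, mul_smul]
      exact A.smul_mem n hmx
    · rw [mul_smul]
      exact A.smul_mem m hny
  | smul q x _ hx =>
    obtain ⟨n, hn, hnx⟩ := hx
    refine ⟨q.den * n, mul_ne_zero (by exact_mod_cast q.den_nz) hn, ?_⟩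
    have h : ((q.den : ℤ) * n) • q • x = q.num • n • x := by
      rw [← Int.cast_smul_eq_zsmul ℚ, ← Int.cast_smul_eq_zsmul ℚ, ← Int.cast_smul_eq_zsmul ℚ,
        smul_smul, smul_smul]
      congr 1
      push_cast
      rw [mul_right_comm, Rat.den_mul_eq_num]
    rw [h]
    exact A.smul_mem _ hnx

theorem mem_span_rat_of_zsmul_mem {A : Submodule ℤ V} {v : V} {n : ℤ} (hn : n ≠ 0)
    (hv : n • v ∈ A) : v ∈ Submodule.span ℚ (A : Set V) := by
  have h := Submodule.smul_mem _ (n : ℚ)⁻¹ (Submodule.subset_span (R := ℚ) hv)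
  rwa [← Int.cast_smul_eq_zsmul ℚ, inv_smul_smul₀ (by exact_mod_cast hn)] at h

theorem orthogonal_span_rat {Φ : V →ₗ[ℚ] V →ₗ[ℚ] ℚ} {A : Submodule ℤ V} {v : V}
    (h : ∀ a ∈ A, Φ v a = 0) : ∀ u ∈ Submodule.span ℚ (A : Set V), Φ v u = 0 := by
  intro u hu
  have : Submodule.span ℚ (A : Set V) ≤ LinearMap.ker (Φ v) :=
    Submodule.span_le.2 fun a ha => h a ha
  exact this hu

theorem Submodule.FG.free_int_of_rat {Γ : Submodule ℤ V} (hfg : Γ.FG) : Module.Free ℤ Γ := by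
  have := Module.Finite.iff_fg.2 hfg
  have : Module.IsTorsionFree ℤ Γ := by
    rw [Module.isTorsionFree_iff_smul_eq_zero]
    intro n v h
    have h' : (n : ℚ) • (v : V) = 0 := by
      rw [Int.cast_smul_eq_zsmul, ← Submodule.coe_smul, h, Submodule.coe_zero]
    simpa using h'
  infer_instance

theorem finiteDimensional_of_span_rat_eq_top {Γ : Submodule ℤ V}
    (hspan : Submodule.span ℚ (Γ : Set V) = ⊤) (hfg : Γ.FG) : FiniteDimensional ℚ V := by
  obtain ⟨s, rfl⟩ := hfg
  rw [Submodule.span_span_of_tower] at hspan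
  exact ⟨s, hspan⟩

theorem exists_rat_linear_extension {Γ : Submodule ℤ V} (hfg : Γ.FG) (f : Γ →ₗ[ℤ] ℚ) :
    ∃ F : V →ₗ[ℚ] ℚ, ∀ g : Γ, F g = f g := by
  have := hfg.free_int_of_rat
  let b := Module.Free.chooseBasis ℤ Γ
  have hli : LinearIndependent ℚ fun i => (b i : V) :=
    (LinearIndependent.iff_fractionRing ℤ ℚ).1
      (b.linearIndependent.map' Γ.subtype Γ.ker_subtype)
  have hext : ∀ F : V →ₗ[ℚ] ℚ, (∀ i, F (b i) = f (b i)) → ∀ g : Γ, F g = f g := by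
    intro F hF g
    have : (F.restrictScalars ℤ).comp Γ.subtype = f := b.ext fun i => hF i
    exact DFunLike.congr_fun this g
  obtain ⟨F, hF⟩ := LinearMap.exists_extend
    ((Module.Basis.span hli).constr ℚ fun i => f (b i))
  refine ⟨F, hext F fun i => ?_⟩
  have h := DFunLike.congr_fun hF (Module.Basis.span hli i)
  rwa [Module.Basis.constr_basis, LinearMap.comp_apply, Submodule.subtype_apply,
    Module.Basis.span_apply] at h

variable {Φ : V →ₗ[ℚ] V →ₗ[ℚ] ℚ} {Γ : Submodule ℤ V}

theorem eq_zero_of_orthogonal_of_selfdual (hspan : Submodule.span ℚ (Γ : Set V) = ⊤)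
    (hfg : Γ.FG) (hselfdual : dualLattice Φ Γ = Γ) {x : V} (hx : ∀ y, Φ x y = 0) : x = 0 := by
  have := Module.Finite.iff_fg.2 hfg
  have := hfg.free_int_of_rat
  have hmem (q : ℚ) : q • x ∈ Γ := by
    rw [← hselfdual]
    exact ⟨by simp [hspan], fun l _ => ⟨0, by simp [hx]⟩⟩
  let b := Module.Free.chooseBasis ℤ Γ
  by_contra hne
  have hrepr : b.repr ⟨x, by simpa using hmem 1⟩ ≠ 0 := by
    simpa using hne
  obtain ⟨i, hi⟩ := Finsupp.ne_iff.1 hrepr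
  set c := b.repr ⟨x, by simpa using hmem 1⟩ i
  rw [Finsupp.zero_apply] at hi
  have h2 : (2 * c) • (⟨((2 * c : ℤ) : ℚ)⁻¹ • x, hmem _⟩ : Γ) = ⟨x, by simpa using hmem 1⟩ := by
    ext
    have : ((2 * c : ℤ) : ℚ) ≠ 0 := by exact_mod_cast mul_ne_zero two_ne_zero hi
    rw [Submodule.coe_smul, ← Int.cast_smul_eq_zsmul ℚ, smul_inv_smul₀ this]
  have h3 := congrArg (fun v => b.repr v i) h2
  simp only [map_smul, Finsupp.smul_apply, smul_eq_mul] at h3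
  change 2 * c * _ = c at h3
  rw [mul_right_comm, mul_left_eq_self₀] at h3
  omega

theorem exists_mem_forall_apply_eq (hspan : Submodule.span ℚ (Γ : Set V) = ⊤) (hfg : Γ.FG)
    (hselfdual : dualLattice Φ Γ = Γ) {A : Submodule ℤ V} (hAΓ : A ≤ Γ)
    (hprim : ∀ x ∈ Γ, (∃ n : ℤ, n ≠ 0 ∧ n • x ∈ A) → x ∈ A) {x : V}
    (hx : x ∈ dualLattice Φ A) : ∃ g ∈ Γ, ∀ a ∈ A, Φ g a = Φ x a := by
  have := finiteDimensional_of_span_rat_eq_top hspan hfg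
  obtain ⟨P, hPA, hP⟩ := exists_retraction_of_primitive hfg hprim
  obtain ⟨F, hF⟩ := exists_rat_linear_extension hfg
    (((Φ x).restrictScalars ℤ).comp (Γ.subtype.comp P))
  have hinj : Function.Injective Φ := by
    rw [injective_iff_map_eq_zero]
    intro v hv
    exact eq_zero_of_orthogonal_of_selfdual hspan hfg hselfdual fun y => by simp [hv]
  obtain ⟨g, rfl⟩ := (LinearMap.injective_iff_surjective_of_finrank_eq_finrank
    Subspace.dual_finrank_eq.symm).1 hinj F
  refine ⟨g, ?_, fun a ha => ?_⟩
  · rw [← hselfdual]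
    refine ⟨by simp [hspan], fun l hl => ?_⟩
    obtain ⟨n, hn⟩ := hx.2 _ (hPA ⟨l, hl⟩)
    exact ⟨n, (hF ⟨l, hl⟩).trans hn⟩
  · refine (hF ⟨a, hAΓ ha⟩).trans ?_
    simp [hP ⟨a, hAΓ ha⟩ ha]

theorem isCompl_span_rat_orthogonal (hspan : Submodule.span ℚ (Γ : Set V) = ⊤) (hfg : Γ.FG)
    (hsymm : ∀ x y : V, Φ x y = Φ y x) {L : Submodule ℤ V}
    (hdisj : L ⊓ (Γ ⊓ orthogonalTo Φ L) = ⊥) :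
    IsCompl (Submodule.span ℚ (L : Set V))
      (Submodule.span ℚ ((Γ ⊓ orthogonalTo Φ L : Submodule ℤ V) : Set V)) := by
  have := finiteDimensional_of_span_rat_eq_top hspan hfg
  have horth : Submodule.span ℚ ((Γ ⊓ orthogonalTo Φ L : Submodule ℤ V) : Set V) =
      LinearMap.BilinForm.orthogonal Φ (Submodule.span ℚ (L : Set V)) := by
    apply le_antisymm
    · rw [Submodule.span_le]
      intro v hv u hu
      exact (hsymm u v).trans (orthogonal_span_rat hv.2 u hu)
    · intro v hv
      obtain ⟨n, hn, hnv⟩ := exists_zsmul_mem_of_mem_span_rat (A := Γ) (v := v) (by simp [hspan])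
      refine mem_span_rat_of_zsmul_mem hn ⟨hnv, (orthogonalTo Φ L).smul_mem n fun y hy => ?_⟩
      exact (hsymm v y).trans (hv y (Submodule.subset_span hy))
  have hdisj' : Disjoint (Submodule.span ℚ (L : Set V))
      (Submodule.span ℚ ((Γ ⊓ orthogonalTo Φ L : Submodule ℤ V) : Set V)) := by
    rw [Submodule.disjoint_def]
    intro v hv hv'
    obtain ⟨m, hm, hmv⟩ := exists_zsmul_mem_of_mem_span_rat hv
    obtain ⟨n, hn, hnv⟩ := exists_zsmul_mem_of_mem_span_rat hv'
    have h : (m * n) • v ∈ L ⊓ (Γ ⊓ orthogonalTo Φ L) := by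
      refine ⟨?_, ?_⟩
      · rw [mul_comm, mul_smul]
        exact L.smul_mem n hmv
      · rw [mul_smul]
        exact Submodule.smul_mem _ m hnv
    rw [hdisj, Submodule.mem_bot, ← Int.cast_smul_eq_zsmul ℚ, smul_eq_zero] at h
    exact h.resolve_left (by exact_mod_cast mul_ne_zero hm hn)
  rw [horth] at hdisj' ⊢
  exact (LinearMap.BilinForm.isCompl_orthogonal_iff_disjoint
    fun x y h => (hsymm y x).trans h).2 hdisj'

/-- Projecting a selfdual lattice onto the rational span of a primitive sublattice maps it
onto the discriminant group of that sublattice. -/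
theorem exists_linearMap_discGroup (hspan : Submodule.span ℚ (Γ : Set V) = ⊤) (hfg : Γ.FG)
    (hsymm : ∀ x y : V, Φ x y = Φ y x) (hint : ∀ x ∈ Γ, ∀ y ∈ Γ, ∃ n : ℤ, Φ x y = n)
    (hselfdual : dualLattice Φ Γ = Γ) {A : Submodule ℤ V} (hAΓ : A ≤ Γ)
    (hprim : ∀ x ∈ Γ, (∃ n : ℤ, n ≠ 0 ∧ n • x ∈ A) → x ∈ A) {W : Submodule ℚ V}
    (hc : IsCompl (Submodule.span ℚ (A : Set V)) W) (horth : ∀ a ∈ A, ∀ w ∈ W, Φ w a = 0) :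
    ∃ f : Γ →ₗ[ℤ] DiscGroup Φ A, Function.Surjective f ∧
      ∀ (g : Γ) (x : dualLattice Φ A), f g = Submodule.Quotient.mk x ↔
        (Submodule.span ℚ (A : Set V)).projection W hc g - x ∈ A := by
  set p := (Submodule.span ℚ (A : Set V)).projection W hc with hp
  have hpa (v : V) (a : V) (ha : a ∈ A) : Φ (p v) a = Φ v a := by
    have := horth a ha _ (Submodule.sub_projection_mem hc v)
    rw [map_sub, LinearMap.sub_apply, sub_eq_zero] at this
    exact this.symm
  have hpd (g : Γ) : p g ∈ dualLattice Φ A :=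
    ⟨Submodule.projection_apply_mem hc _, fun l hl => by
      rw [hpa _ _ hl]
      exact hint _ g.2 _ (hAΓ hl)⟩
  let p' : Γ →ₗ[ℤ] dualLattice Φ A :=
    ((p.restrictScalars ℤ).comp Γ.subtype).codRestrict (dualLattice Φ A) hpd
  refine ⟨(latticeInDual Φ A).mkQ.comp p', fun q => ?_, fun g x => ?_⟩
  · obtain ⟨x, rfl⟩ := (latticeInDual Φ A).mkQ_surjective q
    obtain ⟨g, hg, hgx⟩ := exists_mem_forall_apply_eq hspan hfg hselfdual hAΓ hprim x.2
    refine ⟨⟨g, hg⟩, congrArg (latticeInDual Φ A).mkQ (Subtype.ext (sub_eq_zero.1 ?_))⟩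
    change p g - x = 0
    have hmem : p g - x ∈ Submodule.span ℚ (A : Set V) :=
      Submodule.sub_mem _ (Submodule.projection_apply_mem hc _) x.2.1
    refine eq_zero_of_orthogonal_of_selfdual hspan hfg hselfdual fun y => ?_
    rw [← Submodule.projection_add_projection_eq_self hc y, map_add]
    rw [orthogonal_span_rat (fun a ha => ?_) _ (Submodule.projection_apply_mem hc y), zero_add,
      hsymm]
    · exact orthogonal_span_rat
        (fun a ha => horth a ha _ (Submodule.projection_apply_mem hc.symm y)) _ hmem
    · rw [map_sub, LinearMap.sub_apply, hpa _ _ ha, hgx a ha, sub_self]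
  · exact Submodule.Quotient.eq (latticeInDual Φ A)

end RationalLattice

/-- Nikulin's lemma, first half. Let `Γ` be an even selfdual lattice
and `L ⊆ Γ` a primitive sublattice with `L ∩ L^⊥ = {0}`. Then there is a group
isomorphism `φ : L*/L ≃ (L^⊥)*/L^⊥` under which the discriminant forms differ by sign:
whenever `y ∈ (L^⊥)*` represents `φ(x̄)` for a representative `x ∈ L*`, one has
`⟨y,y⟩ + ⟨x,x⟩ ∈ 2ℤ`. -/
theorem stmt_0 {V : Type*} [AddCommGroup V] [Module ℚ V]
    (Φ : V →ₗ[ℚ] V →ₗ[ℚ] ℚ)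
    (Γ : Submodule ℤ V)
    (hspan : Submodule.span ℚ (Γ : Set V) = ⊤) (hfg : Γ.FG)
    (hsymm : ∀ x y : V, Φ x y = Φ y x)
    (hint : ∀ x ∈ Γ, ∀ y ∈ Γ, ∃ n : ℤ, Φ x y = n)
    (heven : ∀ x ∈ Γ, ∃ n : ℤ, Φ x x = 2 * n)
    (hselfdual : dualLattice Φ Γ = Γ)
    (L : Submodule ℤ V) (hLΓ : L ≤ Γ)
    (hprim : ∀ x ∈ Γ, (∃ n : ℤ, n ≠ 0 ∧ n • x ∈ L) → x ∈ L)
    (Lperp : Submodule ℤ V) (hLperp : Lperp = Γ ⊓ orthogonalTo Φ L)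
    (hdisj : L ⊓ Lperp = ⊥) :
    ∃ φ : DiscGroup Φ L ≃+ DiscGroup Φ Lperp,
      ∀ (x : dualLattice Φ L) (y : dualLattice Φ Lperp),
        φ (Submodule.Quotient.mk x) = Submodule.Quotient.mk y →
        ∃ n : ℤ, Φ (y : V) (y : V) + Φ (x : V) (x : V) = 2 * n := by
  subst hLperp
  have hc := isCompl_span_rat_orthogonal hspan hfg hsymm hdisj
  have hLW : ∀ a ∈ L, ∀ w ∈ Submodule.span ℚ ((Γ ⊓ orthogonalTo Φ L : Submodule ℤ V) : Set V),
      Φ w a = 0 := fun a ha w hw =>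
    (hsymm w a).trans (orthogonal_span_rat (fun m (hm : m ∈ Γ ⊓ orthogonalTo Φ L) => (hsymm a m).trans (hm.2 a ha)) w hw)
  have hWL : ∀ a ∈ Γ ⊓ orthogonalTo Φ L, ∀ w ∈ Submodule.span ℚ (L : Set V), Φ w a = 0 :=
    fun a ha w hw => (hsymm w a).trans (orthogonal_span_rat ha.2 w hw)
  have hprim' : ∀ x ∈ Γ, (∃ n : ℤ, n ≠ 0 ∧ n • x ∈ Γ ⊓ orthogonalTo Φ L) →
      x ∈ Γ ⊓ orthogonalTo Φ L := by
    rintro x hx ⟨n, hn, hnx⟩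
    exact ⟨hx, fun y hy => hLW y hy x (mem_span_rat_of_zsmul_mem hn hnx)⟩
  obtain ⟨f, hf, hfx⟩ :=
    exists_linearMap_discGroup hspan hfg hsymm hint hselfdual hLΓ hprim hc hLW
  obtain ⟨h, hh, hhx⟩ :=
    exists_linearMap_discGroup hspan hfg hsymm hint hselfdual inf_le_left hprim' hc.symm hWL
  have hker : LinearMap.ker f = LinearMap.ker h := by
    ext g
    have hf0 := hfx g 0
    have hh0 := hhx g 0
    have hsum := Submodule.projection_add_projection_eq_self hc (g : V)
    rw [Submodule.Quotient.mk_zero, ZeroMemClass.coe_zero, sub_zero] at hf0 hh0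
    rw [LinearMap.mem_ker, LinearMap.mem_ker, hf0, hh0]
    constructor
    · intro hg
      refine hprim' _ ?_ (exists_zsmul_mem_of_mem_span_rat
        (Submodule.projection_apply_mem hc.symm _))
      rw [eq_sub_of_add_eq' hsum]
      exact Γ.sub_mem g.2 (hLΓ hg)
    · intro hg
      refine hprim _ ?_ (exists_zsmul_mem_of_mem_span_rat (Submodule.projection_apply_mem hc _))
      rw [eq_sub_of_add_eq hsum]
      exact Γ.sub_mem g.2 hg.1
  refine ⟨((f.quotKerEquivOfSurjective hf).symm.trans ((Submodule.quotEquivOfEq _ _ hker).trans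
    (h.quotKerEquivOfSurjective hh))).toAddEquiv, fun x y hxy => ?_⟩
  obtain ⟨g, hg⟩ := hf (Submodule.Quotient.mk x)
  have hgy : h g = Submodule.Quotient.mk y := by
    rw [← hxy, ← hg]
    simp
  have hx := hLΓ ((hfx g x).1 hg)
  have hy := ((hhx g y).1 hgy).1
  have hsum := Submodule.projection_add_projection_eq_self hc (g : V)
  have hmem : (x : V) + y ∈ Γ := by
    have := Γ.sub_mem g.2 (Γ.add_mem hx hy)
    rw [sub_add_sub_comm, hsum, sub_sub_cancel] at this
    exact this
  obtain ⟨n, hn⟩ := heven _ hmem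
  have hzero : Φ (x : V) (y : V) = 0 :=
    orthogonal_span_rat (fun a ha => hWL a ha x x.2.1) y y.2.1
  refine ⟨n, ?_⟩
  rw [← hn]
  simp only [map_add, LinearMap.add_apply, hsymm y x, hzero]
  ring
end

section
/- Let L and L' be even nondegenerate ℤ-lattices and let γ : L*/L → (L')*/L' be a group isomorphism of their discriminant groups satisfying q_{L'}(γ(x̄)) = −q_L(x̄) for all x̄. Define Γ := {(l, l') ∈ L* ⊕ (L')* : γ(l̄) = l̄'}, equipped with the bilinear form ⟨(l₁,l₁'),(l₂,l₂')⟩ := ⟨l₁,l₂⟩ + ⟨l₁',l₂'⟩. Then this form takes integer values on Γ, Γ is an even selfdual lattice, L embeds into Γ as L ⊕ {0}, L' embeds as {0} ⊕ L', and the orthogonal complement of L ⊕ {0} in Γ equals {0} ⊕ L'. -/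
/-- The orthogonal direct sum of the two bilinear forms on `V × W`:
`⟨(l₁,l₁'),(l₂,l₂')⟩ = ⟨l₁,l₂⟩ + ⟨l₁',l₂'⟩`. -/
def prodForm {V W : Type*} [AddCommGroup V] [Module ℚ V] [AddCommGroup W] [Module ℚ W]
    (Φ : V →ₗ[ℚ] V →ₗ[ℚ] ℚ) (Ψ : W →ₗ[ℚ] W →ₗ[ℚ] ℚ) :
    (V × W) →ₗ[ℚ] (V × W) →ₗ[ℚ] ℚ :=
  LinearMap.mk₂ ℚ (fun p q => Φ p.1 q.1 + Ψ p.2 q.2)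
    (fun p p' q => by simp; ring)
    (fun c p q => by simp; ring)
    (fun p q q' => by simp; ring)
    (fun c p q => by simp; ring)

/-- The glued lattice `Γ = {(l,l') ∈ L* ⊕ (L')* : γ(l̄) = l̄'}`. -/
def glueLattice {V W : Type*} [AddCommGroup V] [Module ℚ V] [AddCommGroup W] [Module ℚ W]
    (Φ : V →ₗ[ℚ] V →ₗ[ℚ] ℚ) (Ψ : W →ₗ[ℚ] W →ₗ[ℚ] ℚ)
    (Λ : Submodule ℤ V) (Λ' : Submodule ℤ W)
    (γ : DiscGroup Φ Λ ≃+ DiscGroup Ψ Λ') : Submodule ℤ (V × W) where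
  carrier := {p | ∃ (hx : p.1 ∈ dualLattice Φ Λ) (hy : p.2 ∈ dualLattice Ψ Λ'),
      γ (Submodule.Quotient.mk ⟨p.1, hx⟩) = Submodule.Quotient.mk ⟨p.2, hy⟩}
  zero_mem' := by
    refine ⟨Submodule.zero_mem _, Submodule.zero_mem _, ?_⟩
    have h0 : (⟨(0 : V × W).1, Submodule.zero_mem _⟩ : dualLattice Φ Λ) = 0 := rfl
    have h0' : (⟨(0 : V × W).2, Submodule.zero_mem _⟩ : dualLattice Ψ Λ') = 0 := rfl
    rw [h0, h0']
    simp
  add_mem' := by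
    rintro p q ⟨hp1, hp2, hp⟩ ⟨hq1, hq2, hq⟩
    refine ⟨Submodule.add_mem _ hp1 hq1, Submodule.add_mem _ hp2 hq2, ?_⟩
    have h1 : (⟨(p + q).1, Submodule.add_mem _ hp1 hq1⟩ : dualLattice Φ Λ)
        = ⟨p.1, hp1⟩ + ⟨q.1, hq1⟩ := rfl
    have h2 : (⟨(p + q).2, Submodule.add_mem _ hp2 hq2⟩ : dualLattice Ψ Λ')
        = ⟨p.2, hp2⟩ + ⟨q.2, hq2⟩ := rfl
    rw [h1, h2, Submodule.Quotient.mk_add, Submodule.Quotient.mk_add, map_add, hp, hq]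
  smul_mem' := by
    rintro c p ⟨hp1, hp2, hp⟩
    refine ⟨Submodule.smul_mem _ c hp1, Submodule.smul_mem _ c hp2, ?_⟩
    have h1 : (⟨(c • p).1, Submodule.smul_mem _ c hp1⟩ : dualLattice Φ Λ)
        = c • ⟨p.1, hp1⟩ := rfl
    have h2 : (⟨(c • p).2, Submodule.smul_mem _ c hp2⟩ : dualLattice Ψ Λ')
        = c • ⟨p.2, hp2⟩ := rfl
    rw [h1, h2, Submodule.Quotient.mk_smul, Submodule.Quotient.mk_smul, map_zsmul, hp]

/-- A nondegenerate form on a lattice is nondegenerate on its rationalization. -/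
theorem nondegenerate_of_lattice {V : Type*} [AddCommGroup V] [Module ℚ V]
    {Φ : V →ₗ[ℚ] V →ₗ[ℚ] ℚ} {Λ : Submodule ℤ V}
    (hspan : Submodule.span ℚ (Λ : Set V) = ⊤)
    (hnondeg : ∀ x ∈ Λ, (∀ y ∈ Λ, Φ x y = 0) → x = 0) {x : V}
    (hx : ∀ l ∈ Λ, Φ x l = 0) : x = 0 := by
  obtain ⟨t, ht⟩ := multiple_mem_span_of_mem_localization_span (nonZeroDivisors ℤ) ℚ
    (Λ : Set V) x (hspan ▸ Submodule.mem_top)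
  rw [Submodule.span_eq] at ht
  have htx : ((t : ℤ) : ℚ) • x = 0 := by
    rw [Int.cast_smul_eq_zsmul]
    refine hnondeg _ ht fun y hy => ?_
    rw [← Int.cast_smul_eq_zsmul ℚ, map_smul, LinearMap.smul_apply, hx y hy,
      smul_zero]
  exact (smul_eq_zero.mp htx).resolve_left
    (Int.cast_ne_zero.mpr (nonZeroDivisors.coe_ne_zero t))

theorem mem_dualLattice_iff {V : Type*} [AddCommGroup V] [Module ℚ V]
    {Φ : V →ₗ[ℚ] V →ₗ[ℚ] ℚ} {Λ : Submodule ℤ V}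
    (hspan : Submodule.span ℚ (Λ : Set V) = ⊤) {x : V} :
    x ∈ dualLattice Φ Λ ↔ ∀ l ∈ Λ, ∃ n : ℤ, Φ x l = n :=
  ⟨fun h => h.2, fun h => ⟨hspan ▸ Submodule.mem_top, h⟩⟩

theorem dualLattice_eq_dualSubmodule {V : Type*} [AddCommGroup V] [Module ℚ V]
    {Φ : V →ₗ[ℚ] V →ₗ[ℚ] ℚ} {Λ : Submodule ℤ V}
    (hspan : Submodule.span ℚ (Λ : Set V) = ⊤) :
    dualLattice Φ Λ = LinearMap.BilinForm.dualSubmodule Φ Λ := by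
  ext x
  rw [mem_dualLattice_iff hspan, LinearMap.BilinForm.mem_dualSubmodule]
  simp only [Submodule.mem_one, eq_intCast, eq_comm]

theorem le_dualLattice {V : Type*} [AddCommGroup V] [Module ℚ V]
    {Φ : V →ₗ[ℚ] V →ₗ[ℚ] ℚ} {Λ : Submodule ℤ V}
    (hint : ∀ x ∈ Λ, ∀ y ∈ Λ, ∃ n : ℤ, Φ x y = n) : Λ ≤ dualLattice Φ Λ :=
  fun x hx => ⟨Submodule.subset_span hx, hint x hx⟩

/-- A lattice spanning a rational vector space has a basis which is also a rational basis. -/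
theorem exists_basis_span_eq_lattice {V : Type*} [AddCommGroup V] [Module ℚ V]
    {Λ : Submodule ℤ V} (hspan : Submodule.span ℚ (Λ : Set V) = ⊤) (hfg : Λ.FG) :
    ∃ (n : ℕ) (b : Module.Basis (Fin n) ℚ V), Submodule.span ℤ (Set.range b) = Λ := by
  have : Submodule.IsLattice ℚ Λ := ⟨hfg, hspan⟩
  have : Module.IsTorsionFree ℤ V := Module.IsTorsionFree.trans_faithfulSMul ℤ ℚ V
  have : Module.Finite ℤ Λ := Module.Finite.iff_fg.mpr hfg
  let b := Module.finBasis ℤ Λ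
  refine ⟨_, b.extendOfIsLattice ℚ, ?_⟩
  have h : Set.range (b.extendOfIsLattice ℚ) = Λ.subtype '' Set.range b := by
    rw [← Set.range_comp]
    exact congrArg Set.range (funext fun i => b.extendOfIsLattice_apply ℚ i)
  rw [h, ← Submodule.map_span, b.span_eq, Submodule.map_top, Submodule.range_subtype]

theorem bilinForm_nondegenerate_of_lattice {V : Type*} [AddCommGroup V] [Module ℚ V]
    {Φ : V →ₗ[ℚ] V →ₗ[ℚ] ℚ} {Λ : Submodule ℤ V}
    (hspan : Submodule.span ℚ (Λ : Set V) = ⊤) (hsymm : ∀ x y : V, Φ x y = Φ y x)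
    (hnondeg : ∀ x ∈ Λ, (∀ y ∈ Λ, Φ x y = 0) → x = 0) :
    LinearMap.BilinForm.Nondegenerate Φ :=
  ⟨fun _ hx => nondegenerate_of_lattice hspan hnondeg fun l _ => hx l,
    fun _ hx => nondegenerate_of_lattice hspan hnondeg fun l _ => (hsymm _ _).trans (hx l)⟩

theorem dualLattice_fg {V : Type*} [AddCommGroup V] [Module ℚ V]
    {Φ : V →ₗ[ℚ] V →ₗ[ℚ] ℚ} {Λ : Submodule ℤ V}
    (hspan : Submodule.span ℚ (Λ : Set V) = ⊤) (hfg : Λ.FG)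
    (hsymm : ∀ x y : V, Φ x y = Φ y x)
    (hnondeg : ∀ x ∈ Λ, (∀ y ∈ Λ, Φ x y = 0) → x = 0) : (dualLattice Φ Λ).FG := by
  obtain ⟨n, b, hb⟩ := exists_basis_span_eq_lattice hspan hfg
  rw [dualLattice_eq_dualSubmodule hspan, ← hb, LinearMap.BilinForm.dualSubmodule_span_of_basis Φ
    (bilinForm_nondegenerate_of_lattice hspan hsymm hnondeg) b]
  exact Submodule.fg_span (Set.finite_range _)

/-- A vector pairing integrally with the dual lattice lies in the lattice. -/
theorem mem_of_forall_mem_dualLattice {V : Type*} [AddCommGroup V] [Module ℚ V]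
    {Φ : V →ₗ[ℚ] V →ₗ[ℚ] ℚ} {Λ : Submodule ℤ V}
    (hspan : Submodule.span ℚ (Λ : Set V) = ⊤) (hfg : Λ.FG)
    (hsymm : ∀ x y : V, Φ x y = Φ y x)
    (hnondeg : ∀ x ∈ Λ, (∀ y ∈ Λ, Φ x y = 0) → x = 0) {x : V}
    (hx : ∀ y ∈ dualLattice Φ Λ, ∃ n : ℤ, Φ x y = n) : x ∈ Λ := by
  obtain ⟨n, b, hb⟩ := exists_basis_span_eq_lattice hspan hfg
  have key := LinearMap.BilinForm.dualSubmodule_dualSubmodule_of_basis (R := ℤ) (B := Φ)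
    (bilinForm_nondegenerate_of_lattice hspan hsymm hnondeg) ⟨hsymm⟩ b
  rw [hb, ← dualLattice_eq_dualSubmodule hspan] at key
  rw [← key, LinearMap.BilinForm.mem_dualSubmodule]
  intro y hy
  obtain ⟨m, hm⟩ := hx y hy
  exact Submodule.mem_one.mpr ⟨m, hm.symm⟩

theorem prodForm_apply {V W : Type*} [AddCommGroup V] [Module ℚ V] [AddCommGroup W] [Module ℚ W]
    (Φ : V →ₗ[ℚ] V →ₗ[ℚ] ℚ) (Ψ : W →ₗ[ℚ] W →ₗ[ℚ] ℚ) (p q : V × W) :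
    prodForm Φ Ψ p q = Φ p.1 q.1 + Ψ p.2 q.2 := rfl


/-- Nikulin's lemma, second half. Given even nondegenerate lattices
`Λ ⊆ V`, `Λ' ⊆ W` and an isomorphism `γ` of their discriminant groups reversing the
sign of the discriminant forms, the glued lattice
`Γ = {(l,l') ∈ Λ* ⊕ Λ'* : γ(l̄) = l̄'}` with the sum form is an integral even selfdual
lattice, `Λ` embeds as `Λ ⊕ 0`, `Λ'` embeds as `0 ⊕ Λ'`, and the orthogonal complement
of `Λ ⊕ 0` in `Γ` is exactly `0 ⊕ Λ'`. -/
theorem stmt_1 {V W : Type*} [AddCommGroup V] [Module ℚ V] [AddCommGroup W] [Module ℚ W]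
    (Φ : V →ₗ[ℚ] V →ₗ[ℚ] ℚ) (Ψ : W →ₗ[ℚ] W →ₗ[ℚ] ℚ)
    (Λ : Submodule ℤ V) (Λ' : Submodule ℤ W)
    (hspan : Submodule.span ℚ (Λ : Set V) = ⊤) (hfg : Λ.FG)
    (hspan' : Submodule.span ℚ (Λ' : Set W) = ⊤) (hfg' : Λ'.FG)
    (hsymm : ∀ x y : V, Φ x y = Φ y x) (hsymm' : ∀ x y : W, Ψ x y = Ψ y x)
    (hint : ∀ x ∈ Λ, ∀ y ∈ Λ, ∃ n : ℤ, Φ x y = n)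
    (hint' : ∀ x ∈ Λ', ∀ y ∈ Λ', ∃ n : ℤ, Ψ x y = n)
    (heven : ∀ x ∈ Λ, ∃ n : ℤ, Φ x x = 2 * n)
    (heven' : ∀ x ∈ Λ', ∃ n : ℤ, Ψ x x = 2 * n)
    (hnondeg : ∀ x ∈ Λ, (∀ y ∈ Λ, Φ x y = 0) → x = 0)
    (hnondeg' : ∀ x ∈ Λ', (∀ y ∈ Λ', Ψ x y = 0) → x = 0)
    (γ : DiscGroup Φ Λ ≃+ DiscGroup Ψ Λ')
    (hγ : ∀ (x : dualLattice Φ Λ) (y : dualLattice Ψ Λ'),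
      γ (Submodule.Quotient.mk x) = Submodule.Quotient.mk y →
      ∃ n : ℤ, Ψ (y : W) (y : W) + Φ (x : V) (x : V) = 2 * n) :
    (∀ p ∈ glueLattice Φ Ψ Λ Λ' γ, ∀ q ∈ glueLattice Φ Ψ Λ Λ' γ,
        ∃ n : ℤ, prodForm Φ Ψ p q = n) ∧
    (∀ p ∈ glueLattice Φ Ψ Λ Λ' γ, ∃ n : ℤ, prodForm Φ Ψ p p = 2 * n) ∧
    (glueLattice Φ Ψ Λ Λ' γ).FG ∧
    dualLattice (prodForm Φ Ψ) (glueLattice Φ Ψ Λ Λ' γ) = glueLattice Φ Ψ Λ Λ' γ ∧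
    (∀ l ∈ Λ, ((l, 0) : V × W) ∈ glueLattice Φ Ψ Λ Λ' γ) ∧
    (∀ l' ∈ Λ', ((0, l') : V × W) ∈ glueLattice Φ Ψ Λ Λ' γ) ∧
    (∀ p ∈ glueLattice Φ Ψ Λ Λ' γ,
      (∀ l ∈ Λ, prodForm Φ Ψ p ((l, 0) : V × W) = 0) ↔ ∃ l' ∈ Λ', p = ((0, l') : V × W)) := by
  have eL : ∀ l ∈ Λ, ((l, 0) : V × W) ∈ glueLattice Φ Ψ Λ Λ' γ := fun l hl => by
    refine ⟨le_dualLattice hint hl, Submodule.zero_mem _, ?_⟩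
    rw [(Submodule.Quotient.mk_eq_zero _).mpr (show _ ∈ latticeInDual Φ Λ from hl), map_zero]
    rfl
  have eR : ∀ l' ∈ Λ', ((0, l') : V × W) ∈ glueLattice Φ Ψ Λ Λ' γ := fun l' hl => by
    refine ⟨Submodule.zero_mem _, le_dualLattice hint' hl, ?_⟩
    rw [(Submodule.Quotient.mk_eq_zero _).mpr (show _ ∈ latticeInDual Ψ Λ' from hl)]
    exact map_zero γ
  have even : ∀ p ∈ glueLattice Φ Ψ Λ Λ' γ, ∃ n : ℤ, prodForm Φ Ψ p p = 2 * n := by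
    rintro p ⟨hx, hy, h⟩
    obtain ⟨n, hn⟩ := hγ _ _ h
    exact ⟨n, by rw [prodForm_apply, add_comm, hn]⟩
  have psymm : ∀ p q, prodForm Φ Ψ p q = prodForm Φ Ψ q p := fun p q => by
    rw [prodForm_apply, prodForm_apply, hsymm, hsymm']
  have integral : ∀ p ∈ glueLattice Φ Ψ Λ Λ' γ, ∀ q ∈ glueLattice Φ Ψ Λ Λ' γ,
      ∃ n : ℤ, prodForm Φ Ψ p q = n := by
    intro p hp q hq
    obtain ⟨a, ha⟩ := even p hp
    obtain ⟨b, hb⟩ := even q hq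
    obtain ⟨c, hc⟩ := even (p + q) (Submodule.add_mem _ hp hq)
    refine ⟨c - a - b, ?_⟩
    simp only [map_add, LinearMap.add_apply, ha, hb, psymm q p] at hc
    push_cast
    linarith
  refine ⟨integral, even, ?_, le_antisymm ?_ (le_dualLattice integral), eL, eR, ?_⟩
  · have hfgD : ((dualLattice Φ Λ).prod (dualLattice Ψ Λ')).FG :=
      (dualLattice_fg hspan hfg hsymm hnondeg).prod (dualLattice_fg hspan' hfg' hsymm' hnondeg')
    exact Submodule.FG.of_le hfgD fun p ⟨hx, hy, _⟩ => ⟨hx, hy⟩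
  · rintro ⟨x, y⟩ ⟨-, h⟩
    have hx : x ∈ dualLattice Φ Λ := (mem_dualLattice_iff hspan).mpr fun l hl => by
      simpa [prodForm_apply] using h _ (eL l hl)
    have hy : y ∈ dualLattice Ψ Λ' := (mem_dualLattice_iff hspan').mpr fun l hl => by
      simpa [prodForm_apply] using h _ (eR l hl)
    obtain ⟨⟨z, hz⟩, hxz⟩ := Submodule.Quotient.mk_surjective _
      (γ (Submodule.Quotient.mk ⟨x, hx⟩))
    have hxzΓ : ((x, z) : V × W) ∈ glueLattice Φ Ψ Λ Λ' γ := ⟨hx, hz, hxz.symm⟩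
    have hyz : y - z ∈ Λ' := by
      refine mem_of_forall_mem_dualLattice hspan' hfg' hsymm' hnondeg' fun w' hw' => ?_
      obtain ⟨⟨w, hw⟩, hww⟩ := Submodule.Quotient.mk_surjective _
        (γ.symm (Submodule.Quotient.mk ⟨w', hw'⟩))
      have hwΓ : ((w, w') : V × W) ∈ glueLattice Φ Ψ Λ Λ' γ :=
        ⟨hw, hw', (AddEquiv.eq_symm_apply γ).mp hww⟩
      obtain ⟨a, ha⟩ := h _ hwΓ
      obtain ⟨b, hb⟩ := integral _ hxzΓ _ hwΓ
      refine ⟨a - b, ?_⟩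
      rw [prodForm_apply] at ha hb
      rw [map_sub, LinearMap.sub_apply]
      push_cast
      linarith
    simpa using Submodule.add_mem _ hxzΓ (eR _ hyz)
  · rintro ⟨x, y⟩ ⟨hx, hy, h⟩
    constructor
    · intro hp
      obtain rfl : x = 0 := nondegenerate_of_lattice hspan hnondeg fun l hl => by
        simpa [prodForm_apply] using hp l hl
      refine ⟨y, ?_, rfl⟩
      have h0 : γ (Submodule.Quotient.mk ⟨0, hx⟩) = 0 := map_zero γ
      exact (Submodule.Quotient.mk_eq_zero (latticeInDual Ψ Λ')).mp (h.symm.trans h0)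
    · rintro ⟨l', -, hl⟩ l -
      simp [hl, prodForm_apply]
end

section
/- Let E be a real vector space with a symmetric bilinear form Φ. Let v, v⁰ ∈ E be a hyperbolic pair (Φ(v,v) = Φ(v⁰,v⁰) = 0, Φ(v,v⁰) = 1) and let H ⊆ E be a subspace with Φ(v,h) = Φ(v⁰,h) = 0 for all h ∈ H. Let Σ ⊆ H be a 3-dimensional subspace on which Φ is positive definite, let B ∈ H, and let V > 0. Set ξ := v⁰ + B + (V − Φ(B,B)/2)·v and Ξ := ℝξ + {σ − Φ(B,σ)·v : σ ∈ Σ}. Then Ξ is a 4-dimensional subspace of E on which Φ is positive definite, ξ is Φ-orthogonal to every element of {σ − Φ(B,σ)·v : σ ∈ Σ}, and Ξ ∩ (H + ℝv) = {σ − Φ(B,σ)·v : σ ∈ Σ}. -/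
/-- inverse Aspinwall–Morrison construction. Given a hyperbolic pair
`v, v⁰` orthogonal to a subspace `H`, a positive definite 3-dimensional `Σ ≤ H`,
`B ∈ H` and `V > 0`, the subspace `Ξ` spanned by `ξ := v⁰ + B + (V − Φ(B,B)/2)·v`
and `U = {σ − Φ(B,σ)·v : σ ∈ Σ}` is a positive definite 4-plane, `ξ ⊥ U`, and
`Ξ ∩ (H + ℝv) = U`. -/
theorem stmt_9 {E : Type*} [AddCommGroup E] [Module ℝ E]
    (Φ : E →ₗ[ℝ] E →ₗ[ℝ] ℝ) (hsymm : ∀ x y : E, Φ x y = Φ y x)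
    (v v₀ : E) (hvv : Φ v v = 0) (hv0v0 : Φ v₀ v₀ = 0) (hvv0 : Φ v v₀ = 1)
    (H : Submodule ℝ E) (hvH : ∀ h ∈ H, Φ v h = 0) (hv0H : ∀ h ∈ H, Φ v₀ h = 0)
    (Sgm : Submodule ℝ E) (hSgmH : Sgm ≤ H) (hSgmdim : Module.finrank ℝ Sgm = 3)
    (hSgmpos : ∀ x ∈ Sgm, x ≠ 0 → 0 < Φ x x)
    (B : E) (hB : B ∈ H) (V : ℝ) (hV : 0 < V)
    (ξ : E) (hξ : ξ = v₀ + B + (V - Φ B B / 2) • v)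
    (U : Submodule ℝ E)
    (hU : U = Submodule.map (LinearMap.id - (Φ B).smulRight v) Sgm)
    (Ξ : Submodule ℝ E) (hΞ : Ξ = Submodule.span ℝ {ξ} ⊔ U) :
    Module.finrank ℝ Ξ = 4 ∧
    (∀ x ∈ Ξ, x ≠ 0 → 0 < Φ x x) ∧
    (∀ u ∈ U, Φ ξ u = 0) ∧
    Ξ ⊓ (H ⊔ Submodule.span ℝ {v}) = U := by
  have hv0v : Φ v₀ v = 1 := by rw [hsymm, hvv0]
  have hvB : Φ v B = 0 := hvH B hB
  have hBv : Φ B v = 0 := by rw [hsymm, hvB]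
  have hv0B : Φ v₀ B = 0 := hv0H B hB
  have hBv0 : Φ B v₀ = 0 := by rw [hsymm, hv0B]
  have hξξ : Φ ξ ξ = 2 * V := by
    simp only [hξ, map_add, map_smul, LinearMap.add_apply, LinearMap.smul_apply, smul_eq_mul,
      hvv, hv0v0, hvv0, hv0v, hvB, hBv, hv0B, hBv0]
    ring
  have hvξ : Φ v ξ = 1 := by
    simp [hξ, hvv, hvv0, hvB]
  have hmem : ∀ u ∈ U, ∃ s ∈ Sgm, u = s - Φ B s • v := by
    intro u hu
    rw [hU] at hu
    obtain ⟨s, hs, rfl⟩ := hu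
    exact ⟨s, hs, by simp⟩
  have hvU : ∀ u ∈ U, Φ v u = 0 := by
    intro u hu
    obtain ⟨s, hs, rfl⟩ := hmem u hu
    simp [hvv, hvH s (hSgmH hs)]
  have horth : ∀ u ∈ U, Φ ξ u = 0 := by
    intro u hu
    obtain ⟨s, hs, rfl⟩ := hmem u hu
    simp [hξ, hvv, hv0v, hBv, hvH s (hSgmH hs), hv0H s (hSgmH hs)]
  have hUpos : ∀ u ∈ U, u ≠ 0 → 0 < Φ u u := by
    intro u hu hu0
    obtain ⟨s, hs, rfl⟩ := hmem u hu
    have hvs := hvH s (hSgmH hs)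
    have hsv : Φ s v = 0 := by rw [hsymm, hvs]
    have hs0 : s ≠ 0 := by
      rintro rfl
      simp at hu0
    simpa [hvv, hvs, hsv] using hSgmpos s hs hs0
  have hdecomp : ∀ x ∈ Ξ, ∃ a : ℝ, ∃ u ∈ U, x = a • ξ + u := by
    intro x hx
    rw [hΞ] at hx
    obtain ⟨y, hy, u, hu, rfl⟩ := Submodule.mem_sup.1 hx
    obtain ⟨a, rfl⟩ := Submodule.mem_span_singleton.1 hy
    exact ⟨a, u, hu, rfl⟩
  refine ⟨?_, ?_, horth, ?_⟩
  · have hinj : Function.Injective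
        ((LinearMap.id - (Φ B).smulRight v : E →ₗ[ℝ] E).domRestrict Sgm) := by
      rw [← LinearMap.ker_eq_bot, LinearMap.ker_eq_bot']
      rintro ⟨s, hs⟩ h
      have hsv : s = Φ B s • v := by
        simpa [sub_eq_zero] using h
      have hss : Φ s s = 0 := by
        rw [hsv]
        simp [hvv]
      by_contra hne
      exact (hSgmpos s hs fun h0 => hne (Subtype.ext h0)).ne' hss
    have hUdim : Module.finrank ℝ U = 3 := by
      rw [hU, ← hSgmdim, ← LinearMap.range_domRestrict]
      exact LinearMap.finrank_range_of_inj hinj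
    have : FiniteDimensional ℝ U := Module.finite_of_finrank_pos (by omega)
    have hξ0 : ξ ≠ 0 := by
      rintro h
      simp [h] at hvξ
    have hdisj : Submodule.span ℝ {ξ} ⊓ U = ⊥ := by
      rw [eq_bot_iff]
      rintro x ⟨hx, hxU⟩
      obtain ⟨a, rfl⟩ := Submodule.mem_span_singleton.1 hx
      have ha : a = 0 := by simpa [hvξ] using hvU _ hxU
      simp [ha]
    have hsum := Submodule.finrank_sup_add_finrank_inf_eq (Submodule.span ℝ {ξ}) U
    rw [hdisj, finrank_bot, finrank_span_singleton hξ0, hUdim, ← hΞ] at hsum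
    omega
  · intro x hx hx0
    obtain ⟨a, u, hu, rfl⟩ := hdecomp x hx
    have huξ : Φ u ξ = 0 := by rw [hsymm, horth u hu]
    have hval : Φ (a • ξ + u) (a • ξ + u) = 2 * V * a ^ 2 + Φ u u := by
      simp only [map_add, map_smul, LinearMap.add_apply, LinearMap.smul_apply, smul_eq_mul,
        hξξ, huξ, horth u hu]
      ring
    rw [hval]
    by_cases hu0 : u = 0
    · have ha : a ≠ 0 := by
        rintro rfl
        simp [hu0] at hx0
      simp only [hu0, map_zero, add_zero]
      positivity
    · have := hUpos u hu hu0
      positivity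
  · apply le_antisymm
    · rintro x ⟨hx, hxH⟩
      obtain ⟨a, u, hu, rfl⟩ := hdecomp x hx
      obtain ⟨h, hh, y, hy, hxy⟩ := Submodule.mem_sup.1 hxH
      obtain ⟨b, rfl⟩ := Submodule.mem_span_singleton.1 hy
      have hΦ := congrArg (Φ v) hxy
      have ha : a = 0 := by
        simpa [hvH h hh, hvv, hvξ, hvU u hu, eq_comm] using hΦ
      simpa [ha] using hu
    · intro u hu
      refine ⟨hΞ ▸ Submodule.mem_sup_right hu, ?_⟩
      obtain ⟨s, hs, rfl⟩ := hmem u hu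
      exact sub_mem (Submodule.mem_sup_left (hSgmH hs))
        (Submodule.mem_sup_right (Submodule.smul_mem _ _ (Submodule.mem_span_singleton_self v)))
end
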